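/- arXiv:1511.08746 — 2 statements merged into one kernel-verified Lean document; each statement's English description precedes it below -/
import Mathlib

section
/- Let H be a real m×n matrix with n ≥ 2 whose columns are all nonzero, and suppose its mutual coherence satisfies μ(H) > 0. If the natural number k satisfies k < (1/2)(1 + 1/μ(H)), then for every y ∈ ℝ^m there exists at most one k-sparse vector s ∈ ℝ^n satisfying y = H s. -/
open Matrix

/-- The ℓ0-"norm": number of nonzero entries of a vector. -/
noncomputable def l0 {n : ℕ} (s : Fin n → ℝ) : ℕ := (Finset.univ.filter (fun i => s i ≠ 0)).card

/-- The `i`-th column of `H`. -/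
def col {m n : ℕ} (H : Matrix (Fin m) (Fin n) ℝ) (i : Fin n) : Fin m → ℝ :=
  fun a => H a i

/-- The mutual coherence of `H`: the largest magnitude of the normalized inner
product between two distinct columns of `H`. -/
noncomputable def mu {m n : ℕ} (H : Matrix (Fin m) (Fin n) ℝ) : ℝ :=
  sSup {x : ℝ | ∃ i j : Fin n, i ≠ j ∧
    x = |_root_.col H i ⬝ᵥ _root_.col H j| /
        (Real.sqrt (_root_.col H i ⬝ᵥ _root_.col H i) * Real.sqrt (_root_.col H j ⬝ᵥ _root_.col H j))}

/-- Inner products of distinct columns are bounded by the coherence times the column norms. -/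
lemma abs_col_dotProduct_col_le_mu {m n : ℕ} (H : Matrix (Fin m) (Fin n) ℝ) {i j : Fin n}
    (hij : i ≠ j) (hi : 0 < √(_root_.col H i ⬝ᵥ _root_.col H i))
    (hj : 0 < √(_root_.col H j ⬝ᵥ _root_.col H j)) :
    |_root_.col H i ⬝ᵥ _root_.col H j| ≤ mu H *
      (√(_root_.col H i ⬝ᵥ _root_.col H i) * √(_root_.col H j ⬝ᵥ _root_.col H j)) := by
  rw [← div_le_iff₀ (mul_pos hi hj)]
  refine le_csSup (Set.Finite.bddAbove ?_) ⟨i, j, hij, rfl⟩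
  refine (Set.finite_range fun p : Fin n × Fin n =>
    |_root_.col H p.1 ⬝ᵥ _root_.col H p.2| /
      (√(_root_.col H p.1 ⬝ᵥ _root_.col H p.1) * √(_root_.col H p.2 ⬝ᵥ _root_.col H p.2))).subset ?_
  rintro x ⟨i, j, -, rfl⟩
  exact ⟨(i, j), rfl⟩

lemma l0_sub_le {n : ℕ} (s t : Fin n → ℝ) : l0 (s - t) ≤ l0 s + l0 t := by
  refine (Finset.card_le_card fun i hi => ?_).trans (Finset.card_union_le _ _)
  simp only [Finset.mem_union, Finset.mem_filter, Finset.mem_univ, true_and, Pi.sub_apply] at hi ⊢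
  by_contra! h
  exact hi (by rw [h.1, h.2, sub_zero])

lemma col_dotProduct_mulVec {m n : ℕ} (H : Matrix (Fin m) (Fin n) ℝ) (d : Fin n → ℝ) (p : Fin n) :
    _root_.col H p ⬝ᵥ H.mulVec d = ∑ j, d j * (_root_.col H p ⬝ᵥ _root_.col H j) := by
  simp only [dotProduct, Matrix.mulVec, _root_.col, Finset.mul_sum]
  rw [Finset.sum_comm]
  exact Finset.sum_congr rfl fun j _ => Finset.sum_congr rfl fun a _ => by ring

/-- A nonzero kernel vector has at least `1 + 1 / μ(H)` nonzero entries. -/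
lemma one_le_mu_mul_l0_sub_one {m n : ℕ} (H : Matrix (Fin m) (Fin n) ℝ)
    (hcols : ∀ i : Fin n, _root_.col H i ≠ 0) (hmu : 0 < mu H) {d : Fin n → ℝ}
    (hd : d ≠ 0) (hker : H.mulVec d = 0) : 1 ≤ mu H * ((l0 d : ℝ) - 1) := by
  set N : Fin n → ℝ := fun i => √(_root_.col H i ⬝ᵥ _root_.col H i)
  have hnonneg (i : Fin n) : 0 ≤ _root_.col H i ⬝ᵥ _root_.col H i :=
    Finset.sum_nonneg fun a _ => mul_self_nonneg _
  have hNpos (i : Fin n) : 0 < N i :=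
    Real.sqrt_pos.2 ((hnonneg i).lt_of_ne' (mt dotProduct_self_eq_zero.1 (hcols i)))
  obtain ⟨q, hq⟩ := Function.ne_iff.1 hd
  obtain ⟨p, -, hp⟩ := Finset.exists_max_image Finset.univ (fun i => |d i| * N i) ⟨q, Finset.mem_univ q⟩
  have hwp : 0 < |d p| * N p :=
    (mul_pos (abs_pos.2 hq) (hNpos q)).trans_le (hp q (Finset.mem_univ q))
  have hdp : d p ≠ 0 := fun h => by simp [h] at hwp
  set S : Finset (Fin n) := Finset.univ.filter fun i => d i ≠ 0 with hS
  have hpS : p ∈ S := by simp [hS, hdp]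
  have hsum : ∑ j ∈ S, d j * (_root_.col H p ⬝ᵥ _root_.col H j) = 0 := by
    rw [Finset.sum_subset (Finset.subset_univ S), ← col_dotProduct_mulVec, hker, dotProduct_zero]
    intro j _ hj
    have : d j = 0 := by simpa [hS] using hj
    rw [this, zero_mul]
  rw [← Finset.add_sum_erase S _ hpS] at hsum
  have hself : _root_.col H p ⬝ᵥ _root_.col H p = N p * N p := (Real.mul_self_sqrt (hnonneg p)).symm
  have hcard : ((S.erase p).card : ℝ) = (l0 d : ℝ) - 1 := by
    rw [Finset.card_erase_of_mem hpS, Nat.cast_sub (Finset.card_pos.2 ⟨p, hpS⟩), Nat.cast_one]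
    rfl
  have hbound : |d p| * N p * N p ≤ mu H * ((l0 d : ℝ) - 1) * (|d p| * N p * N p) := calc
    |d p| * N p * N p = |d p * (_root_.col H p ⬝ᵥ _root_.col H p)| := by
      rw [hself, abs_mul, abs_of_nonneg (mul_self_nonneg (N p)), mul_assoc]
    _ = |∑ j ∈ S.erase p, d j * (_root_.col H p ⬝ᵥ _root_.col H j)| := by
      rw [eq_neg_of_add_eq_zero_left hsum, abs_neg]
    _ ≤ ∑ j ∈ S.erase p, |d j * (_root_.col H p ⬝ᵥ _root_.col H j)| :=
      Finset.abs_sum_le_sum_abs _ _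
    _ ≤ ∑ _j ∈ S.erase p, mu H * (|d p| * N p * N p) := by
      refine Finset.sum_le_sum fun j hj => ?_
      have hcoh := abs_col_dotProduct_col_le_mu H (Finset.ne_of_mem_erase hj).symm (hNpos p) (hNpos j)
      calc |d j * (_root_.col H p ⬝ᵥ _root_.col H j)|
          ≤ |d j| * (mu H * (N p * N j)) := by
            rw [abs_mul]
            exact mul_le_mul_of_nonneg_left hcoh (abs_nonneg _)
        _ = mu H * (|d j| * N j * N p) := by ring
        _ ≤ mu H * (|d p| * N p * N p) :=
            mul_le_mul_of_nonneg_left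
              (mul_le_mul_of_nonneg_right (hp j (Finset.mem_univ j)) (hNpos p).le) hmu.le
    _ = mu H * ((l0 d : ℝ) - 1) * (|d p| * N p * N p) := by
      rw [Finset.sum_const, nsmul_eq_mul, hcard]
      ring
  exact (le_mul_iff_one_le_left (mul_pos hwp (hNpos p))).1 hbound

/-- If `k < (1/2)(1 + 1/μ(H))`, then for every measurement vector there is at most
one `k`-sparse vector `s` with `y = H s`. -/
theorem coherence_sparse_uniqueness
    {m n : ℕ} (H : Matrix (Fin m) (Fin n) ℝ) (hn : 2 ≤ n)
    (hcols : ∀ i : Fin n, _root_.col H i ≠ 0) (hmu : 0 < mu H)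
    (k : ℕ) (hk : (k : ℝ) < (1 / 2) * (1 + 1 / mu H)) :
    ∀ s₁ s₂ : Fin n → ℝ, l0 s₁ ≤ k → l0 s₂ ≤ k →
      H.mulVec s₁ = H.mulVec s₂ → s₁ = s₂ := by
  intro s₁ s₂ h₁ h₂ heq
  by_contra hne
  have hspark := one_le_mu_mul_l0_sub_one H hcols hmu (sub_ne_zero.2 hne)
    (by rw [Matrix.mulVec_sub, heq, sub_self])
  have hl0 : (l0 (s₁ - s₂) : ℝ) ≤ 2 * k := by
    exact_mod_cast (l0_sub_le s₁ s₂).trans (by omega)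
  have hlt : (l0 (s₁ - s₂) : ℝ) - 1 < 1 / mu H := by linarith
  rw [lt_div_iff₀ hmu] at hlt
  linarith
end

section
/- Let H be a real m×n matrix with m ≤ n, n ≥ 2, rank(H) = m, and all columns of H nonzero. Then the mutual coherence of H satisfies √((n−m)/(m(n−1))) ≤ μ(H) ≤ 1. -/
open Matrix

/-- The squared Frobenius norm of a real symmetric matrix is the trace of its square. -/
lemma sum_sq_eq_trace_mul_self {α : Type*} [Fintype α] {A : Matrix α α ℝ} (hA : A.IsSymm) :
    ∑ i, ∑ j, A i j ^ 2 = (A * A).trace := by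
  simp only [trace, diag_apply, mul_apply]
  refine Finset.sum_congr rfl fun i _ => Finset.sum_congr rfl fun j _ => ?_
  rw [sq, hA.apply i j]

/-- The matrices `UᵀU` and `UUᵀ` have the same Frobenius norm. -/
lemma sum_sq_transpose_mul_self {ι κ : Type*} [Fintype ι] [Fintype κ] (U : Matrix ι κ ℝ) :
    ∑ i, ∑ j, (Uᵀ * U) i j ^ 2 = ∑ a, ∑ b, (U * Uᵀ) a b ^ 2 := by
  have hgram : (Uᵀ * U).IsSymm := by simp [IsSymm]
  have hframe : (U * Uᵀ).IsSymm := by simp [IsSymm]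
  rw [sum_sq_eq_trace_mul_self hgram, sum_sq_eq_trace_mul_self hframe, Matrix.mul_assoc,
    trace_mul_comm]
  simp only [Matrix.mul_assoc]

/-- The trace of a Gram matrix of vectors in `ℝ^ι` is controlled by its Frobenius norm. -/
lemma sq_trace_transpose_mul_self_le {ι κ : Type*} [Fintype ι] [Fintype κ] (U : Matrix ι κ ℝ) :
    (Uᵀ * U).trace ^ 2 ≤ Fintype.card ι * ∑ i, ∑ j, (Uᵀ * U) i j ^ 2 := by
  rw [sum_sq_transpose_mul_self, trace_mul_comm]
  calc (U * Uᵀ).trace ^ 2 ≤ Fintype.card ι * ∑ a, (U * Uᵀ) a a ^ 2 :=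
        sq_sum_le_card_mul_sum_sq
    _ ≤ _ := by
        gcongr with a
        exact Finset.single_le_sum (f := fun b => (U * Uᵀ) a b ^ 2)
          (fun b _ => sq_nonneg _) (Finset.mem_univ a)

/-- The Welch inequality for unit vectors with pairwise inner products bounded by `c`. -/
lemma welch_inequality {m n : ℕ} (U : Matrix (Fin m) (Fin n) ℝ) {c : ℝ}
    (hdiag : ∀ i, (Uᵀ * U) i i = 1) (hoff : ∀ i j, i ≠ j → |(Uᵀ * U) i j| ≤ c) :
    (n : ℝ) ^ 2 ≤ m * (n * (1 + (n - 1) * c ^ 2)) := by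
  have htr : (Uᵀ * U).trace = n := by simp [trace, hdiag]
  have hrow : ∀ i, ∑ j, (Uᵀ * U) i j ^ 2 ≤ 1 + (n - 1) * c ^ 2 := by
    intro i
    rw [← Finset.add_sum_erase _ _ (Finset.mem_univ i), hdiag, one_pow]
    gcongr
    refine (Finset.sum_le_card_nsmul _ _ (c ^ 2) fun j hj => ?_).trans_eq ?_
    · exact sq_le_sq' (abs_le.mp (hoff i j (Finset.ne_of_mem_erase hj).symm)).1
        (abs_le.mp (hoff i j (Finset.ne_of_mem_erase hj).symm)).2
    · have : 1 ≤ n := i.pos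
      simp [Finset.card_erase_of_mem, Nat.cast_sub this]
  have h := sq_trace_transpose_mul_self_le U
  rw [htr, Fintype.card_fin] at h
  refine h.trans ?_
  gcongr
  simpa [mul_add] using Finset.sum_le_card_nsmul Finset.univ _ _ fun i _ => hrow i

/-- The Cauchy–Schwarz inequality for normalized dot products. -/
lemma abs_dotProduct_div_le_one {ι : Type*} [Fintype ι] (v w : ι → ℝ) :
    |v ⬝ᵥ w| / (Real.sqrt (v ⬝ᵥ v) * Real.sqrt (w ⬝ᵥ w)) ≤ 1 := by
  refine div_le_one_of_le₀ ?_ (by positivity)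
  have hv : 0 ≤ v ⬝ᵥ v := Finset.sum_nonneg fun i _ => mul_self_nonneg (v i)
  rw [← Real.sqrt_mul hv]
  refine Real.abs_le_sqrt ?_
  simpa [dotProduct, sq] using Finset.sum_mul_sq_le_sq_mul_sq Finset.univ v w

/-- For a full (row-)rank `m×n` matrix with `m ≤ n`, `n ≥ 2`, and nonzero columns,
the mutual coherence satisfies `√((n−m)/(m(n−1))) ≤ μ(H) ≤ 1`. -/
theorem coherence_welch_bound
    {m n : ℕ} (H : Matrix (Fin m) (Fin n) ℝ) (hmn : m ≤ n) (hn : 2 ≤ n)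
    (hrank : H.rank = m) (hcols : ∀ i : Fin n, _root_.col H i ≠ 0) :
    Real.sqrt (((n : ℝ) - m) / (m * ((n : ℝ) - 1))) ≤ mu H ∧ mu H ≤ 1 := by
  have hle : ∀ i j : Fin n, i ≠ j → |_root_.col H i ⬝ᵥ _root_.col H j| /
      (Real.sqrt (_root_.col H i ⬝ᵥ _root_.col H i) *
        Real.sqrt (_root_.col H j ⬝ᵥ _root_.col H j)) ≤ mu H := fun i j hij =>
    le_csSup ⟨1, by rintro _ ⟨i, j, -, rfl⟩; exact abs_dotProduct_div_le_one _ _⟩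
      ⟨i, j, hij, rfl⟩
  refine ⟨?_, Real.sSup_le (by rintro _ ⟨i, j, -, rfl⟩; exact abs_dotProduct_div_le_one _ _)
    zero_le_one⟩
  have hmu : 0 ≤ mu H := Real.sSup_nonneg (by rintro _ ⟨i, j, -, rfl⟩; positivity)
  have hm : 0 < m := by
    rcases Nat.eq_zero_or_pos m with rfl | h
    · exact absurd (Subsingleton.elim _ _) (hcols ⟨0, by omega⟩)
    · exact h
  let U : Matrix (Fin m) (Fin n) ℝ :=
    Matrix.of fun a i => H a i / Real.sqrt (_root_.col H i ⬝ᵥ _root_.col H i)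
  have hU : ∀ i j, (Uᵀ * U) i j = (_root_.col H i ⬝ᵥ _root_.col H j) /
      (Real.sqrt (_root_.col H i ⬝ᵥ _root_.col H i) *
        Real.sqrt (_root_.col H j ⬝ᵥ _root_.col H j)) := by
    intro i j
    rw [mul_apply, dotProduct, Finset.sum_div]
    exact Finset.sum_congr rfl fun a _ => div_mul_div_comm _ _ _ _
  have hpos : ∀ i, 0 < _root_.col H i ⬝ᵥ _root_.col H i := fun i =>
    (Finset.sum_nonneg fun a _ => mul_self_nonneg (_root_.col H i a)).lt_of_ne'
      (dotProduct_self_eq_zero.not.mpr (hcols i))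
  have hwelch := welch_inequality U (c := mu H)
    (fun i => by rw [hU, Real.mul_self_sqrt (hpos i).le, div_self (hpos i).ne'])
    (fun i j hij => by
      rw [hU, abs_div, abs_of_nonneg (by positivity : 0 ≤ Real.sqrt _ * Real.sqrt _)]
      exact hle i j hij)
  have hn' : (2 : ℝ) ≤ n := by exact_mod_cast hn
  have hm' : (0 : ℝ) < m := by exact_mod_cast hm
  rw [Real.sqrt_le_left hmu, div_le_iff₀ (mul_pos hm' (by linarith))]
  have hcancel : (n : ℝ) ≤ m * (1 + (n - 1) * mu H ^ 2) :=
    le_of_mul_le_mul_left (by linarith) (by linarith : (0 : ℝ) < n)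
  linarith
end
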